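/- Let G be a discrete group, I a nonempty set, T = I × G × I, and let (m_λ)_{λ∈Λ} be a bounded approximate diagonal for ℓ¹(G). For each finite nonempty subset F ⊆ I and λ ∈ Λ, set W_{F,λ} := (1/#F) Σ_{i,j∈F} E^{m_λ}_{(i,j,j,i)} ∈ ℓ¹(T × T) ≅ ℓ¹(T) ⊗̂ ℓ¹(T). Then, with the index set Γ × Λ directed by inclusion of finite subsets of I in the first coordinate, for every a ∈ ℓ¹(T) one has a·W_{F,λ} − W_{F,λ}·a → 0 in norm. -/

import Mathlib

open Filter Topology
open scoped ENNReal TensorProduct Classical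

noncomputable section

/-- The Banach space `ℓ¹(X)` of absolutely summable complex functions on `X`. -/
abbrev l1 (X : Type*) : Type _ := lp (fun _ : X => ℂ) 1

section Defs

variable {I G : Type*} [Group G]

/-- The multiplication of the Brandt semigroup `S = B(I,G) = (I × G × I) ∪ {o}`,
where the zero element `o` is encoded as `none`. -/
def brandtMul : Option (I × G × I) → Option (I × G × I) → Option (I × G × I)
  | some (i, g, j), some (i', g', j') => if j = i' then some (i, g * g', j') else none
  | _, _ => none

/-- Spec: `mul` is the convolution product on `ℓ¹(T)`, `T = I × G × I`:
`(ab)(i,g,j) = Σ_{k ∈ I, h ∈ G} a(i, g h⁻¹, k) b(k, h, j)`. -/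
def IsConvT (mul : l1 (I × G × I) → l1 (I × G × I) → l1 (I × G × I)) : Prop :=
  ∀ (a b : l1 (I × G × I)) (i : I) (g : G) (j : I),
    mul a b (i, g, j) = ∑' p : I × G, a (i, g * p.2⁻¹, p.1) * b (p.1, p.2, j)

/-- Spec: `mul` is the convolution product on the group algebra `ℓ¹(G)`. -/
def IsConvG (mul : l1 G → l1 G → l1 G) : Prop :=
  ∀ (a b : l1 G) (g : G), mul a b g = ∑' h : G, a (g * h⁻¹) * b h

/-- Spec: `act` is the left module action of `ℓ¹(T)` on `ℓ¹(T × T) = ℓ¹(T) ⊗̂ ℓ¹(T)`,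
determined by `a·(x ⊗ y) = (ax) ⊗ y`. -/
def IsLeftActT
    (act : l1 (I × G × I) → l1 ((I × G × I) × (I × G × I)) → l1 ((I × G × I) × (I × G × I))) :
    Prop :=
  ∀ (a : l1 (I × G × I)) (w : l1 ((I × G × I) × (I × G × I))) (i : I) (g : G) (j : I)
    (t' : I × G × I),
    act a w ((i, g, j), t') = ∑' p : I × G, a (i, g * p.2⁻¹, p.1) * w ((p.1, p.2, j), t')

/-- Spec: `act` is the right module action of `ℓ¹(T)` on `ℓ¹(T × T) = ℓ¹(T) ⊗̂ ℓ¹(T)`,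
determined by `(x ⊗ y)·a = x ⊗ (ya)`. -/
def IsRightActT
    (act : l1 ((I × G × I) × (I × G × I)) → l1 (I × G × I) → l1 ((I × G × I) × (I × G × I))) :
    Prop :=
  ∀ (w : l1 ((I × G × I) × (I × G × I))) (a : l1 (I × G × I)) (t : I × G × I) (i : I) (g : G)
    (j : I),
    act w a (t, (i, g, j)) = ∑' p : I × G, w (t, (i, g * p.2⁻¹, p.1)) * a (p.1, p.2, j)

/-- Spec: `d` is the diagonal map `π : ℓ¹(T × T) = ℓ¹(T) ⊗̂ ℓ¹(T) → ℓ¹(T)`,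
determined by `δ_x ⊗ δ_y ↦ δ_x δ_y`. -/
def IsDiagT (d : l1 ((I × G × I) × (I × G × I)) → l1 (I × G × I)) : Prop :=
  ∀ (w : l1 ((I × G × I) × (I × G × I))) (i : I) (g : G) (j : I),
    d w (i, g, j) = ∑' p : I × G, w ((i, g * p.2⁻¹, p.1), (p.1, p.2, j))

/-- Spec: `act` is the left module action of `ℓ¹(G)` on `ℓ¹(G × G) = ℓ¹(G) ⊗̂ ℓ¹(G)`. -/
def IsLeftActG (act : l1 G → l1 (G × G) → l1 (G × G)) : Prop :=
  ∀ (a : l1 G) (w : l1 (G × G)) (g g' : G),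
    act a w (g, g') = ∑' h : G, a (g * h⁻¹) * w (h, g')

/-- Spec: `act` is the right module action of `ℓ¹(G)` on `ℓ¹(G × G) = ℓ¹(G) ⊗̂ ℓ¹(G)`. -/
def IsRightActG (act : l1 (G × G) → l1 G → l1 (G × G)) : Prop :=
  ∀ (w : l1 (G × G)) (a : l1 G) (g g' : G),
    act w a (g, g') = ∑' h : G, w (g, g' * h⁻¹) * a h

/-- Spec: `d` is the diagonal map `π : ℓ¹(G × G) = ℓ¹(G) ⊗̂ ℓ¹(G) → ℓ¹(G)`. -/
def IsDiagG (d : l1 (G × G) → l1 G) : Prop :=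
  ∀ (w : l1 (G × G)) (g : G), d w g = ∑' h : G, w (g * h⁻¹, h)

/-- Spec: `mul` is the convolution product on the semigroup algebra `ℓ¹(S)`, `S = B(I,G)`:
`(ab)(s) = Σ_{u v = s} a(u) b(v)`. -/
def IsConvS (mul : l1 (Option (I × G × I)) → l1 (Option (I × G × I)) →
    l1 (Option (I × G × I))) : Prop :=
  ∀ (a b : l1 (Option (I × G × I))) (s : Option (I × G × I)),
    mul a b s =
      ∑' p : {p : Option (I × G × I) × Option (I × G × I) // brandtMul p.1 p.2 = s},
        a p.val.1 * b p.val.2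

/-- Spec: left module action of `ℓ¹(S)` on `ℓ¹(S × S) = ℓ¹(S) ⊗̂ ℓ¹(S)`. -/
def IsLeftActS (act : l1 (Option (I × G × I)) →
    l1 (Option (I × G × I) × Option (I × G × I)) →
    l1 (Option (I × G × I) × Option (I × G × I))) : Prop :=
  ∀ (a : l1 (Option (I × G × I))) (w : l1 (Option (I × G × I) × Option (I × G × I)))
    (s s' : Option (I × G × I)),
    act a w (s, s') =
      ∑' p : {p : Option (I × G × I) × Option (I × G × I) // brandtMul p.1 p.2 = s},
        a p.val.1 * w (p.val.2, s')

/-- Spec: right module action of `ℓ¹(S)` on `ℓ¹(S × S) = ℓ¹(S) ⊗̂ ℓ¹(S)`. -/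
def IsRightActS (act : l1 (Option (I × G × I) × Option (I × G × I)) →
    l1 (Option (I × G × I)) →
    l1 (Option (I × G × I) × Option (I × G × I))) : Prop :=
  ∀ (w : l1 (Option (I × G × I) × Option (I × G × I))) (a : l1 (Option (I × G × I)))
    (s s' : Option (I × G × I)),
    act w a (s, s') =
      ∑' p : {p : Option (I × G × I) × Option (I × G × I) // brandtMul p.1 p.2 = s'},
        w (s, p.val.1) * a p.val.2

/-- Spec: the diagonal map `π : ℓ¹(S × S) = ℓ¹(S) ⊗̂ ℓ¹(S) → ℓ¹(S)`. -/
def IsDiagS (d : l1 (Option (I × G × I) × Option (I × G × I)) → l1 (Option (I × G × I))) :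
    Prop :=
  ∀ (w : l1 (Option (I × G × I) × Option (I × G × I))) (s : Option (I × G × I)),
    d w s =
      ∑' p : {p : Option (I × G × I) × Option (I × G × I) // brandtMul p.1 p.2 = s},
        w p.val

/-- Spec: `E` sends `b ∈ ℓ¹(G × G)` and `i,j,i',j' ∈ I` to the element
`E^b_{(i,j,i',j')} ∈ ℓ¹(T × T)`. -/
def IsE (E : l1 (G × G) → I → I → I → I → l1 ((I × G × I) × (I × G × I))) : Prop :=
  ∀ (b : l1 (G × G)) (i j i' j' : I),
    (∀ g g' : G, E b i j i' j' ((i, g, j), (i', g', j')) = b (g, g')) ∧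
    (∀ (u v u' v' : I) (g g' : G), (u, v, u', v') ≠ (i, j, i', j') →
      E b i j i' j' ((u, g, v), (u', g', v')) = 0)

/-- Spec: `H` sends `c ∈ ℓ¹(G)` and `i,j ∈ I` to the element `H^c_{(i,j)} ∈ ℓ¹(T)`. -/
def IsH (H : l1 G → I → I → l1 (I × G × I)) : Prop :=
  ∀ (c : l1 G) (i j : I),
    (∀ g : G, H c i j (i, g, j) = c g) ∧
    (∀ (u v : I) (g : G), (u, v) ≠ (i, j) → H c i j (u, g, v) = 0)

/-- Spec: `comp` sends `a ∈ ℓ¹(T)` and `u,v ∈ I` to `a_{(u,v)} ∈ ℓ¹(G)`,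
`a_{(u,v)}(g) = a(u,g,v)`. -/
def IsComp (comp : l1 (I × G × I) → I → I → l1 G) : Prop :=
  ∀ (a : l1 (I × G × I)) (u v : I) (g : G), comp a u v g = a (u, g, v)

/-- The net `W_{F,λ} = (1/#F) Σ_{i,j ∈ F} E^{m_λ}_{(i,j,j,i)}` in `ℓ¹(T × T)`. -/
def Wnet (E : l1 (G × G) → I → I → I → I → l1 ((I × G × I) × (I × G × I)))
    {Λ : Type*} (m : Λ → l1 (G × G)) (F : Finset I) (l : Λ) :
    l1 ((I × G × I) × (I × G × I)) :=
  (F.card : ℂ)⁻¹ • ∑ i ∈ F, ∑ j ∈ F, E (m l) i j j i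

/-- `(m_λ)` is a bounded approximate diagonal for `ℓ¹(G)` (with respect to the given
realizations of the product, the module actions on `ℓ¹(G) ⊗̂ ℓ¹(G) = ℓ¹(G × G)` and
the diagonal map). -/
def IsBddApproxDiagG {Λ : Type*} [Preorder Λ]
    (mulG : l1 G → l1 G → l1 G) (actLG : l1 G → l1 (G × G) → l1 (G × G))
    (actRG : l1 (G × G) → l1 G → l1 (G × G)) (piG : l1 (G × G) → l1 G)
    (m : Λ → l1 (G × G)) : Prop :=
  (∃ M : ℝ, ∀ l, ‖m l‖ ≤ M) ∧
  ∀ c : l1 G,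
    Tendsto (fun l => actLG c (m l) - actRG (m l) c) atTop (𝓝 0) ∧
    Tendsto (fun l => mulG (piG (m l)) c) atTop (𝓝 c)

end Defs

/-- Pseudo-amenability of an `ℓ¹`-type Banach algebra `A = ℓ¹(X)`, whose projective tensor
square `A ⊗̂ A` is realized concretely as `M = ℓ¹(X × X)`: there is a net (equivalently, a
nontrivial filtered family) `w` in `M` such that `a·w_n − w_n·a → 0` and `π(w_n)a → a` for
every `a ∈ A`. -/
def HasApproxDiag {A M : Type*} [NormedAddCommGroup A] [NormedAddCommGroup M]
    (mul : A → A → A) (actL : A → M → M) (actR : M → A → M) (diag : M → A) : Prop :=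
  ∃ (ι : Type*) (F : Filter ι), F.NeBot ∧ ∃ w : ι → M,
    ∀ a : A,
      Tendsto (fun n => actL a (w n) - actR (w n) a) F (𝓝 0) ∧
      Tendsto (fun n => mul (diag (w n)) a) F (𝓝 a)

/-- A discrete group `G` is amenable: there is a left-invariant mean on `ℓ∞(G)`,
i.e. a positive normalized left translation invariant linear functional. -/
def AmenableGroup (G : Type*) [Group G] : Prop :=
  ∃ m : lp (fun _ : G => ℝ) ∞ →ₗ[ℝ] ℝ,
    (∀ f : lp (fun _ : G => ℝ) ∞, (∀ x, 0 ≤ f x) → 0 ≤ m f) ∧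
    (∀ f : lp (fun _ : G => ℝ) ∞, (∀ x, f x = 1) → m f = 1) ∧
    (∀ (g : G) (f f' : lp (fun _ : G => ℝ) ∞), (∀ x, f' x = f (g * x)) → m f' = m f)

/-- The projective tensor seminorm on the algebraic tensor product `A ⊗[ℂ] A`:
the infimum of `Σ ‖x_k‖ ‖y_k‖` over all finite representations `Σ x_k ⊗ y_k`. -/
def projSeminorm (A : Type*) [NormedAddCommGroup A] [NormedSpace ℂ A] (x : A ⊗[ℂ] A) : ℝ :=
  sInf {r : ℝ | ∃ (n : ℕ) (f : Fin n → A × A),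
    x = ∑ k, (f k).1 ⊗ₜ[ℂ] (f k).2 ∧ r = ∑ k, ‖(f k).1‖ * ‖(f k).2‖}

/-- A Banach algebra `A` is pseudo-amenable: there is a net (equivalently, a nontrivial
filtered family) `(w_n)` in `A ⊗̂ A` with `a·w_n − w_n·a → 0` and `π(w_n)a → a` for every
`a ∈ A`, where `π` is the diagonal map and `A ⊗̂ A` carries the projective tensor seminorm. -/
def PseudoAmenable (A : Type*) [NonUnitalNormedRing A] [NormedSpace ℂ A]
    [SMulCommClass ℂ A A] [IsScalarTower ℂ A A] : Prop :=
  ∃ (ι : Type*) (F : Filter ι), F.NeBot ∧ ∃ w : ι → A ⊗[ℂ] A,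
    ∀ a : A,
      Tendsto (fun n => projSeminorm A
        (TensorProduct.map (LinearMap.mulLeft ℂ a) LinearMap.id (w n) -
          TensorProduct.map LinearMap.id (LinearMap.mulRight ℂ a) (w n))) F (𝓝 0) ∧
      Tendsto (fun n => LinearMap.mul' ℂ A (w n) * a) F (𝓝 a)


theorem l1_enorm_eq_tsum {X : Type*} (f : l1 X) : ‖f‖ₑ = ∑' x, ‖f x‖ₑ := by
  have hs : Summable fun x => ‖f x‖ := by
    simpa using (lp.memℓp f).summable (by simp)
  have hn : ‖f‖ = ∑' x, ‖f x‖ := by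
    simpa using lp.norm_eq_tsum_rpow (p := 1) (by simp) f
  rw [← ofReal_norm, hn, ENNReal.ofReal_tsum_of_nonneg (fun _ => norm_nonneg _) hs]
  simp only [ofReal_norm]

theorem memℓp_one_comp_injective {X Y : Type*} (f : l1 X) {φ : Y → X}
    (hφ : Function.Injective φ) : Memℓp (fun y => f (φ y) : Y → ℂ) 1 := by
  have hs : Summable fun x => ‖f x‖ := by
    simpa using (lp.memℓp f).summable (by simp)
  apply memℓp_gen
  simpa [Function.comp_def] using hs.comp_injective hφ

/-- The component `a_{(u,v)} ∈ ℓ¹(G)` of `a ∈ ℓ¹(T)`. -/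
def l1Comp {I G : Type*} (a : l1 (I × G × I)) (q : I × I) : l1 G :=
  ⟨fun g => a (q.1, g, q.2), memℓp_one_comp_injective a (φ := fun g : G => (q.1, g, q.2))
    fun g g' h => by simpa using h⟩

theorem l1Comp_apply {I G : Type*} (a : l1 (I × G × I)) (q : I × I) (g : G) :
    l1Comp a q g = a (q.1, g, q.2) := rfl

theorem tsum_enorm_l1Comp {I G : Type*} (a : l1 (I × G × I)) :
    ∑' q, ‖l1Comp a q‖ₑ = ‖a‖ₑ := by
  simp only [l1_enorm_eq_tsum, l1Comp_apply]
  rw [ENNReal.tsum_prod', ENNReal.tsum_prod']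
  refine tsum_congr fun u => ?_
  rw [ENNReal.tsum_prod', ENNReal.tsum_comm]

theorem summable_norm_l1Comp {I G : Type*} (a : l1 (I × G × I)) :
    Summable fun q => ‖l1Comp a q‖ := by
  have h : ∑' q, ‖l1Comp a q‖ₑ ≠ ∞ := by
    rw [tsum_enorm_l1Comp]
    exact enorm_ne_top
  simpa using ENNReal.summable_toReal h

section GroupActions

variable {G : Type*} [Group G]

theorem norm_actLG_le {act : l1 G → l1 (G × G) → l1 (G × G)} (hact : IsLeftActG act)
    (c : l1 G) (w : l1 (G × G)) : ‖act c w‖ ≤ ‖c‖ * ‖w‖ := by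
  have key : ‖act c w‖ₑ ≤ ‖c‖ₑ * ‖w‖ₑ := by
    rw [l1_enorm_eq_tsum, ENNReal.tsum_prod']
    calc ∑' (g : G) (g' : G), ‖act c w (g, g')‖ₑ
        ≤ ∑' (g : G) (g' : G) (h : G), ‖c (g * h⁻¹)‖ₑ * ‖w (h, g')‖ₑ := by
          refine ENNReal.tsum_le_tsum fun g => ENNReal.tsum_le_tsum fun g' => ?_
          rw [hact]
          simpa only [enorm_mul] using
            enorm_tsum_le_tsum_enorm (f := fun h : G => c (g * h⁻¹) * w (h, g'))
      _ = ∑' (h : G) (g' : G) (g : G), ‖c (g * h⁻¹)‖ₑ * ‖w (h, g')‖ₑ := by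
          rw [ENNReal.tsum_comm]
          simp_rw [ENNReal.tsum_comm (α := G) (β := G)
            (f := fun g h => ‖c (g * h⁻¹)‖ₑ * ‖w (h, _)‖ₑ)]
          rw [ENNReal.tsum_comm]
      _ = ‖c‖ₑ * ‖w‖ₑ := by
          have hc (h : G) : ∑' g : G, ‖c (g * h⁻¹)‖ₑ = ‖c‖ₑ := by
            rw [l1_enorm_eq_tsum]
            exact (Equiv.mulRight h⁻¹).tsum_eq fun g => ‖c g‖ₑ
          simp_rw [ENNReal.tsum_mul_right, hc, ENNReal.tsum_mul_left]
          rw [l1_enorm_eq_tsum w, ENNReal.tsum_prod']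
  have := ENNReal.toReal_mono (by finiteness) key
  simpa using this

theorem norm_actRG_le {act : l1 (G × G) → l1 G → l1 (G × G)} (hact : IsRightActG act)
    (w : l1 (G × G)) (c : l1 G) : ‖act w c‖ ≤ ‖w‖ * ‖c‖ := by
  have key : ‖act w c‖ₑ ≤ ‖w‖ₑ * ‖c‖ₑ := by
    rw [l1_enorm_eq_tsum, ENNReal.tsum_prod']
    calc ∑' (g : G) (g' : G), ‖act w c (g, g')‖ₑ
        ≤ ∑' (g : G) (g' : G) (h : G), ‖w (g, g' * h⁻¹)‖ₑ * ‖c h‖ₑ := by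
          refine ENNReal.tsum_le_tsum fun g => ENNReal.tsum_le_tsum fun g' => ?_
          rw [hact]
          simpa only [enorm_mul] using
            enorm_tsum_le_tsum_enorm (f := fun h : G => w (g, g' * h⁻¹) * c h)
      _ = ∑' (g : G) (h : G) (g' : G), ‖w (g, g' * h⁻¹)‖ₑ * ‖c h‖ₑ :=
          tsum_congr fun g => ENNReal.tsum_comm
      _ = ‖w‖ₑ * ‖c‖ₑ := by
          have hw (g h : G) : ∑' g' : G, ‖w (g, g' * h⁻¹)‖ₑ = ∑' g' : G, ‖w (g, g')‖ₑ :=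
            (Equiv.mulRight h⁻¹).tsum_eq fun g' => ‖w (g, g')‖ₑ
          simp_rw [ENNReal.tsum_mul_right, hw, ENNReal.tsum_mul_left]
          rw [ENNReal.tsum_mul_right, l1_enorm_eq_tsum w, ENNReal.tsum_prod', l1_enorm_eq_tsum c]
  have := ENNReal.toReal_mono (by finiteness) key
  simpa using this

end GroupActions

section Net

variable {I G Λ : Type*}
  {E : l1 (G × G) → I → I → I → I → l1 ((I × G × I) × (I × G × I))}

theorem IsE.apply (hE : IsE E) (b : l1 (G × G)) (i j i' j' u v u' v' : I) (g g' : G) :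
    E b i j i' j' ((u, g, v), (u', g', v')) =
      if (u, v, u', v') = (i, j, i', j') then b (g, g') else 0 := by
  split_ifs with h
  · simp only [Prod.mk.injEq] at h
    obtain ⟨rfl, rfl, rfl, rfl⟩ := h
    exact (hE b _ _ _ _).1 g g'
  · exact (hE b i j i' j').2 u v u' v' g g' h

theorem Wnet_apply (hE : IsE E) (m : Λ → l1 (G × G)) (F : Finset I) (l : Λ)
    (u v u' v' : I) (g g' : G) :
    Wnet E m F l ((u, g, v), (u', g', v')) =
      if u = v' ∧ v = u' ∧ u ∈ F ∧ v ∈ F then (F.card : ℂ)⁻¹ * m l (g, g') else 0 := by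
  have h : ∑ i ∈ F, ∑ j ∈ F, E (m l) i j j i ((u, g, v), (u', g', v')) =
      if u = v' ∧ v = u' ∧ u ∈ F ∧ v ∈ F then m l (g, g') else 0 := by
    have h' (i j : I) : E (m l) i j j i ((u, g, v), (u', g', v')) =
        if u = i then if v = j then if u = v' ∧ v = u' then m l (g, g') else 0 else 0 else 0 := by
      rw [hE.apply]
      simp only [Prod.mk.injEq]
      split_ifs <;> grind
    simp_rw [h']
    simp only [Finset.sum_ite_eq, Finset.sum_ite_irrel, Finset.sum_const_zero]
    split_ifs <;> grind
  simp only [Wnet, lp.coeFn_smul, lp.coeFn_sum, Pi.smul_apply, Finset.sum_apply, h, smul_eq_mul,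
    mul_ite, mul_zero]

theorem actLT_Wnet_apply [Group G] (hE : IsE E)
    {actLG : l1 G → l1 (G × G) → l1 (G × G)} (hactLG : IsLeftActG actLG)
    {actLT : l1 (I × G × I) → l1 ((I × G × I) × (I × G × I)) → l1 ((I × G × I) × (I × G × I))}
    (hactLT : IsLeftActT actLT) (a : l1 (I × G × I)) (m : Λ → l1 (G × G)) (F : Finset I) (l : Λ)
    (u v u' v' : I) (g g' : G) :
    actLT a (Wnet E m F l) ((u, g, v), (u', g', v')) =
      if v = u' ∧ v ∈ F then
        (F.card : ℂ)⁻¹ * (if v' ∈ F then actLG (l1Comp a (u, v')) (m l) else 0) (g, g')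
      else 0 := by
  have hinj : Function.Injective fun h : G => (v', h) := fun _ _ h => by simpa using h
  rw [hactLT, ← hinj.tsum_eq]
  · simp only [Wnet_apply hE, true_and]
    by_cases h : v = u' ∧ v' ∈ F ∧ v ∈ F
    · simp only [if_pos h, if_pos h.2.1, if_pos (And.intro h.1 h.2.2)]
      rw [hactLG, ← tsum_mul_left]
      refine tsum_congr fun k => ?_
      rw [l1Comp_apply]
      ring
    · simp only [if_neg h, mul_zero, tsum_zero]
      split_ifs with h1 h2
      · exact absurd ⟨h1.1, h2, h1.2⟩ h
      · simp
      · rfl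
  · rintro ⟨k, h⟩ hk
    have : k = v' := by
      by_contra hne
      simp [Wnet_apply hE, hne] at hk
    exact ⟨h, by rw [this]⟩

theorem actRT_Wnet_apply [Group G] (hE : IsE E)
    {actRG : l1 (G × G) → l1 G → l1 (G × G)} (hactRG : IsRightActG actRG)
    {actRT : l1 ((I × G × I) × (I × G × I)) → l1 (I × G × I) → l1 ((I × G × I) × (I × G × I))}
    (hactRT : IsRightActT actRT) (a : l1 (I × G × I)) (m : Λ → l1 (G × G)) (F : Finset I) (l : Λ)
    (u v u' v' : I) (g g' : G) :
    actRT (Wnet E m F l) a ((u, g, v), (u', g', v')) =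
      if v = u' ∧ v ∈ F then
        (F.card : ℂ)⁻¹ * (if u ∈ F then actRG (m l) (l1Comp a (u, v')) else 0) (g, g')
      else 0 := by
  have hinj : Function.Injective fun h : G => (u, h) := fun _ _ h => by simpa using h
  rw [hactRT, ← hinj.tsum_eq]
  · simp only [Wnet_apply hE, true_and]
    by_cases h : v = u' ∧ u ∈ F ∧ v ∈ F
    · simp only [if_pos h, if_pos h.2.1, if_pos (And.intro h.1 h.2.2)]
      rw [hactRG, ← tsum_mul_left]
      refine tsum_congr fun k => ?_
      rw [l1Comp_apply]
      ring
    · simp only [if_neg h, zero_mul, tsum_zero]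
      split_ifs with h1 h2
      · exact absurd ⟨h1.1, h2, h1.2⟩ h
      · simp
      · rfl
  · rintro ⟨k, h⟩ hk
    have : u = k := by
      by_contra hne
      simp [Wnet_apply hE, hne] at hk
    exact ⟨h, by rw [this]⟩

/-- An element of `ℓ¹(T × T)` that is the average over `v ∈ F` of copies, placed at the positions
`(u, v, v, v')`, of a family `D` in `ℓ¹(G × G)` has norm `∑ ‖D (u, v')‖`. -/
theorem enorm_eq_tsum_of_average {F : Finset I} (hF : F.Nonempty)
    (D : I × I → l1 (G × G)) (x : l1 ((I × G × I) × (I × G × I)))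
    (hx : ∀ (u v u' v' : I) (g g' : G), x ((u, g, v), (u', g', v')) =
      if v = u' ∧ v ∈ F then (F.card : ℂ)⁻¹ * D (u, v') (g, g') else 0) :
    ‖x‖ₑ = ∑' q, ‖D q‖ₑ := by
  let e : ((I × I) × (G × G)) × (I × I) ≃ (I × G × I) × (I × G × I) :=
    { toFun := fun p => ((p.1.1.1, p.1.2.1, p.2.1), (p.2.2, p.1.2.2, p.1.1.2))
      invFun := fun t => (((t.1.1, t.2.2.2), (t.1.2.1, t.2.2.1)), (t.1.2.2, t.2.1))
      left_inv := fun _ => rfl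
      right_inv := fun _ => rfl }
  have hcard : (F.card : ℂ) ≠ 0 := by exact_mod_cast hF.card_pos.ne'
  rw [l1_enorm_eq_tsum, ← e.tsum_eq, ENNReal.tsum_prod', ENNReal.tsum_prod']
  refine tsum_congr fun q => ?_
  rw [l1_enorm_eq_tsum]
  refine tsum_congr fun r => ?_
  have hrow (v : I) : ∑' u' : I, ‖x (e ((q, r), (v, u')))‖ₑ =
      if v ∈ F then ‖(F.card : ℂ)⁻¹‖ₑ * ‖D q r‖ₑ else 0 := by
    rw [tsum_eq_single v]
    · change ‖x ((q.1, r.1, v), (v, r.2, q.2))‖ₑ = _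
      rw [hx]
      split_ifs <;> simp_all [enorm_mul]
    · intro u' hu'
      change ‖x ((q.1, r.1, v), (u', r.2, q.2))‖ₑ = _
      rw [hx, if_neg (fun h => hu' h.1.symm), enorm_zero]
  rw [ENNReal.tsum_prod']
  simp_rw [hrow]
  rw [tsum_eq_sum (s := F) (fun v hv => if_neg hv), Finset.sum_congr rfl fun v hv => if_pos hv,
    Finset.sum_const, nsmul_eq_mul, ← mul_assoc]
  have : (F.card : ℝ≥0∞) * ‖(F.card : ℂ)⁻¹‖ₑ = 1 := by
    have h : (F.card : ℝ≥0∞) = ‖(F.card : ℂ)‖ₑ := by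
      rw [← ofReal_norm, Complex.norm_natCast, ENNReal.ofReal_natCast]
    rw [h, ← enorm_mul, mul_inv_cancel₀ hcard, enorm_one]
  rw [this, one_mul]

end Net

theorem W_commutator_tendsto_zero {G : Type*} [Group G] {I : Type*} [Nonempty I]
    {Λ : Type*} [Preorder Λ] [IsDirected Λ (· ≤ ·)] [Nonempty Λ]
    (mulG : l1 G → l1 G → l1 G) (hmulG : IsConvG mulG)
    (actLG : l1 G → l1 (G × G) → l1 (G × G)) (hactLG : IsLeftActG actLG)
    (actRG : l1 (G × G) → l1 G → l1 (G × G)) (hactRG : IsRightActG actRG)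
    (piG : l1 (G × G) → l1 G) (hpiG : IsDiagG piG)
    (m : Λ → l1 (G × G)) (hm : IsBddApproxDiagG mulG actLG actRG piG m)
    (E : l1 (G × G) → I → I → I → I → l1 ((I × G × I) × (I × G × I))) (hE : IsE E)
    (actLT : l1 (I × G × I) → l1 ((I × G × I) × (I × G × I)) → l1 ((I × G × I) × (I × G × I)))
    (hactLT : IsLeftActT actLT)
    (actRT : l1 ((I × G × I) × (I × G × I)) → l1 (I × G × I) → l1 ((I × G × I) × (I × G × I)))
    (hactRT : IsRightActT actRT)
    (a : l1 (I × G × I)) :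
    Filter.Tendsto
      (fun p : {F : Finset I // F.Nonempty} × Λ =>
        actLT a (Wnet E m p.1.val p.2) - actRT (Wnet E m p.1.val p.2) a)
      Filter.atTop (nhds 0) := by
  obtain ⟨⟨M, hM⟩, hm⟩ := hm
  set D : {F : Finset I // F.Nonempty} × Λ → I × I → l1 (G × G) := fun p q =>
    (if q.2 ∈ p.1.val then actLG (l1Comp a q) (m p.2) else 0) -
      (if q.1 ∈ p.1.val then actRG (m p.2) (l1Comp a q) else 0) with hD
  have hbound (p q) : ‖D p q‖ ≤ 2 * M * ‖l1Comp a q‖ := by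
    have hM0 : 0 ≤ M := (norm_nonneg _).trans (hM p.2)
    have hL : ‖if q.2 ∈ p.1.val then actLG (l1Comp a q) (m p.2) else 0‖ ≤ M * ‖l1Comp a q‖ := by
      split_ifs
      · rw [mul_comm]
        exact (norm_actLG_le hactLG _ _).trans (by gcongr; exact hM _)
      · rw [norm_zero]; positivity
    have hR : ‖if q.1 ∈ p.1.val then actRG (m p.2) (l1Comp a q) else 0‖ ≤ M * ‖l1Comp a q‖ := by
      split_ifs
      · exact (norm_actRG_le hactRG _ _).trans (by gcongr; exact hM _)
      · rw [norm_zero]; positivity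
    calc ‖D p q‖ ≤ _ := norm_sub_le _ _
      _ ≤ _ := add_le_add hL hR
      _ = _ := by ring
  have hsum : Summable fun q => 2 * M * ‖l1Comp a q‖ := (summable_norm_l1Comp a).mul_left _
  have hnorm (p : {F : Finset I // F.Nonempty} × Λ) :
      ‖actLT a (Wnet E m p.1.val p.2) - actRT (Wnet E m p.1.val p.2) a‖ = ∑' q, ‖D p q‖ := by
    have h := enorm_eq_tsum_of_average p.1.2 (D p)
      (actLT a (Wnet E m p.1.val p.2) - actRT (Wnet E m p.1.val p.2) a) fun u v u' v' g g' => by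
        rw [lp.coeFn_sub, Pi.sub_apply, actLT_Wnet_apply hE hactLG hactLT,
          actRT_Wnet_apply hE hactRG hactRT, hD, lp.coeFn_sub, Pi.sub_apply]
        split_ifs <;> simp [mul_sub]
    have h' := congrArg ENNReal.toReal h
    rw [ENNReal.tsum_toReal_eq fun _ => enorm_ne_top] at h'
    simpa only [toReal_enorm] using h'
  rw [tendsto_zero_iff_norm_tendsto_zero]
  simp_rw [hnorm]
  rw [← tsum_zero (α := ℝ) (β := I × I)]
  refine tendsto_tsum_of_dominated_convergence hsum (fun q => ?_)
    (Eventually.of_forall fun p q => by simpa using hbound p q)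
  rw [← tendsto_zero_iff_norm_tendsto_zero]
  have hq : Tendsto (fun p : {F : Finset I // F.Nonempty} × Λ =>
      actLG (l1Comp a q) (m p.2) - actRG (m p.2) (l1Comp a q)) atTop (𝓝 0) := by
    rw [← prod_atTop_atTop_eq]
    exact (hm (l1Comp a q)).1.comp tendsto_snd
  refine hq.congr' ?_
  filter_upwards [eventually_ge_atTop
    ((⟨{q.1, q.2}, by simp⟩ : {F : Finset I // F.Nonempty}), Classical.arbitrary Λ)] with p hp
  have hsub : ({q.1, q.2} : Finset I) ⊆ p.1.val := hp.1
  simp only [hD]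
  rw [if_pos (hsub (by simp)), if_pos (hsub (by simp))]

end
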